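/- Let N be a finite set, let b be a natural number with b ≤ |N|, let c ≥ 0 and ε be real numbers, and let g, m, ḡ, ġ : N → ℝ be functions satisfying, for every n ∈ N: ḡ(n) ≤ m(n) ≤ ġ(n), ḡ(n) ≤ g(n) ≤ ġ(n), and ġ(n) − ḡ(n) ≤ c. Let S* ⊆ N with |S*| = b maximize ∑_{n ∈ S} g(n) over all subsets S of cardinality b, let S° ⊆ N with |S°| = b maximize ∑_{n ∈ S} m(n) over all subsets S of cardinality b, and let J ⊆ N with |J| = b satisfy ∑_{n ∈ S°} ḡ(n) − ∑_{n ∈ J} ġ(n) < ε. Then ∑_{n ∈ S*} g(n) − ∑_{n ∈ J} g(n) ≤ 3·b·c + ε. -/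

import Mathlib

/-- If `f ≤ h + c` pointwise on a finset, then the sums differ by at most `card * c`. -/
theorem Finset.sum_le_sum_add_card_mul {α : Type*} {S : Finset α} {f h : α → ℝ} {c : ℝ}
    (hfh : ∀ n ∈ S, f n ≤ h n + c) : ∑ n ∈ S, f n ≤ ∑ n ∈ S, h n + S.card * c := by
  simpa [Finset.sum_add_distrib] using Finset.sum_le_sum hfh

theorem stmt_14 {α : Type*} [DecidableEq α] (N : Finset α) (b : ℕ) (hb : b ≤ N.card)
    (c ε : ℝ) (hc : 0 ≤ c) (g m glo ghi : α → ℝ)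
    (hlo : ∀ n ∈ N, glo n ≤ m n) (hhi : ∀ n ∈ N, m n ≤ ghi n)
    (hglo : ∀ n ∈ N, glo n ≤ g n) (hghi : ∀ n ∈ N, g n ≤ ghi n)
    (hgap : ∀ n ∈ N, ghi n - glo n ≤ c)
    (Sstar : Finset α) (hSstarN : Sstar ⊆ N) (hSstarcard : Sstar.card = b)
    (hSstarmax : ∀ S ⊆ N, S.card = b → ∑ n ∈ S, g n ≤ ∑ n ∈ Sstar, g n)
    (Scirc : Finset α) (hScircN : Scirc ⊆ N) (hScirccard : Scirc.card = b)
    (hScircmax : ∀ S ⊆ N, S.card = b → ∑ n ∈ S, m n ≤ ∑ n ∈ Scirc, m n)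
    (J : Finset α) (hJN : J ⊆ N) (hJcard : J.card = b)
    (hJ : ∑ n ∈ Scirc, glo n - ∑ n ∈ J, ghi n < ε) :
    ∑ n ∈ Sstar, g n - ∑ n ∈ J, g n ≤ 3 * b * c + ε := by
  have hstar : ∑ n ∈ Sstar, g n ≤ ∑ n ∈ Sstar, m n + Sstar.card * c :=
    Finset.sum_le_sum_add_card_mul fun n hn => by
      linarith [hghi n (hSstarN hn), hlo n (hSstarN hn), hgap n (hSstarN hn)]
  have hcirc : ∑ n ∈ Scirc, m n ≤ ∑ n ∈ Scirc, glo n + Scirc.card * c :=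
    Finset.sum_le_sum_add_card_mul fun n hn => by
      linarith [hhi n (hScircN hn), hgap n (hScircN hn)]
  have hJg : ∑ n ∈ J, ghi n ≤ ∑ n ∈ J, g n + J.card * c :=
    Finset.sum_le_sum_add_card_mul fun n hn => by
      linarith [hglo n (hJN hn), hgap n (hJN hn)]
  rw [hSstarcard] at hstar
  rw [hScirccard] at hcirc
  rw [hJcard] at hJg
  linarith [hScircmax Sstar hSstarN hSstarcard]
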